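/- Let α_1 ≥ α_2 ≥ α_3 ≥ 0 be integers and let ξ_1, ξ_2, ξ_3 be integers with ξ_1 + ξ_2 + ξ_3 = α_1 + α_2 + α_3 and α_3 ≤ ξ_i ≤ α_1 for each i = 1, 2, 3 (i.e., ξ lies in the permutahedron of α). Then for every positive integer p, the stretched Kostka number satisfies K_{(pα_1, pα_2, pα_3)}(pξ_1, pξ_2, pξ_3) = p·(K_{(α_1,α_2,α_3)}(ξ_1,ξ_2,ξ_3) − 1) + 1; in particular it is a linear polynomial in p whose leading coefficient is the Schur volume function ℐ_{su(3)}(α;ξ) = K_α(ξ) − 1. -/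

import Mathlib

/-- `kostka α ξ` is the Kostka number associated to the shape `α` (given by its row
lengths `α 0 ≥ α 1 ≥ …`) and the content `ξ` (for `k ≥ 1`, the entry `k` must occur
exactly `ξ k` times): it counts the fillings `T` of the Young diagram
`{(i, j) | j < α i}` with positive integers that weakly increase along rows and
strictly increase down columns, such that for each `k ≥ 1` the entry `k` occurs
exactly `ξ k` times.  (Fillings are normalized to be `0` outside the diagram.) -/
noncomputable def kostka (α : ℕ → ℕ) (ξ : ℕ → ℕ) : ℕ :=
  Nat.card {T : ℕ × ℕ → ℕ //
    (∀ i j, j + 1 < α i → T (i, j) ≤ T (i, j + 1)) ∧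
    (∀ i j, j < α (i + 1) → T (i, j) < T (i + 1, j)) ∧
    (∀ i j, j < α i → 1 ≤ T (i, j)) ∧
    (∀ i j, α i ≤ j → T (i, j) = 0) ∧
    (∀ k, 1 ≤ k → {c : ℕ × ℕ | c.2 < α c.1 ∧ T c = k}.ncard = ξ k)}

/-- The filling of the shape `(α₁, α₂, α₃)` whose first row has its entries `1` before column `x`,
`2` before column `a` and `3` afterwards, whose second row has its entries `2` before column `b` and
`3` afterwards, and whose third row consists of entries `3`. -/
def threeRowFilling (α₁ α₂ α₃ x a b : ℕ) (c : ℕ × ℕ) : ℕ :=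
  if c.1 = 0 then if c.2 < x then 1 else if c.2 < a then 2 else if c.2 < α₁ then 3 else 0
  else if c.1 = 1 then if c.2 < b then 2 else if c.2 < α₂ then 3 else 0
  else if c.1 = 2 then if c.2 < α₃ then 3 else 0
  else 0

theorem lt_getD_three_iff {α₁ α₂ α₃ i j : ℕ} :
    j < [α₁, α₂, α₃].getD i 0 ↔ (i = 0 ∧ j < α₁) ∨ (i = 1 ∧ j < α₂) ∨ (i = 2 ∧ j < α₃) := by
  rcases i with _ | _ | _ | i <;> simp

theorem ncard_threeRowFilling_eq_one {α₁ α₂ α₃ x a b : ℕ} (hx : x ≤ a) (ha : a ≤ α₁) :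
    {c : ℕ × ℕ | c.2 < [α₁, α₂, α₃].getD c.1 0 ∧
      threeRowFilling α₁ α₂ α₃ x a b c = 1}.ncard = x := by
  have h : {c : ℕ × ℕ | c.2 < [α₁, α₂, α₃].getD c.1 0 ∧
      threeRowFilling α₁ α₂ α₃ x a b c = 1} =
      (({0} ×ˢ Finset.range x : Finset (ℕ × ℕ)) : Set (ℕ × ℕ)) := by
    ext ⟨i, j⟩
    simp only [Set.mem_ofPred_eq, lt_getD_three_iff, threeRowFilling, Finset.coe_product,
      Finset.coe_singleton, Finset.coe_range, Set.mem_prod, Set.mem_singleton_iff, Set.mem_Iio]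
    grind
  rw [h, Set.ncard_coe_finset]
  simp

theorem ncard_threeRowFilling_eq_two {α₁ α₂ α₃ x a b : ℕ} (ha : a ≤ α₁) (hb : b ≤ α₂) :
    {c : ℕ × ℕ | c.2 < [α₁, α₂, α₃].getD c.1 0 ∧
      threeRowFilling α₁ α₂ α₃ x a b c = 2}.ncard = (a - x) + b := by
  have h : {c : ℕ × ℕ | c.2 < [α₁, α₂, α₃].getD c.1 0 ∧
      threeRowFilling α₁ α₂ α₃ x a b c = 2} =
      (({0} ×ˢ Finset.Ico x a ∪ {1} ×ˢ Finset.range b : Finset (ℕ × ℕ)) : Set (ℕ × ℕ)) := by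
    ext ⟨i, j⟩
    simp only [Set.mem_ofPred_eq, lt_getD_three_iff, threeRowFilling, Finset.mem_coe,
      Finset.mem_union, Finset.mem_product, Finset.mem_singleton, Finset.mem_Ico, Finset.mem_range]
    grind
  rw [h, Set.ncard_coe_finset, Finset.card_union_of_disjoint]
  · simp
  · rw [Finset.disjoint_left]
    simp only [Finset.mem_product, Finset.mem_singleton]
    grind

theorem ncard_threeRowFilling_eq_three {α₁ α₂ α₃ x a b : ℕ} (hx : x ≤ a) :
    {c : ℕ × ℕ | c.2 < [α₁, α₂, α₃].getD c.1 0 ∧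
      threeRowFilling α₁ α₂ α₃ x a b c = 3}.ncard = (α₁ - a) + (α₂ - b) + α₃ := by
  have h : {c : ℕ × ℕ | c.2 < [α₁, α₂, α₃].getD c.1 0 ∧
      threeRowFilling α₁ α₂ α₃ x a b c = 3} =
      (({0} ×ˢ Finset.Ico a α₁ ∪ {1} ×ˢ Finset.Ico b α₂ ∪ {2} ×ˢ Finset.range α₃ :
        Finset (ℕ × ℕ)) : Set (ℕ × ℕ)) := by
    ext ⟨i, j⟩
    simp only [Set.mem_ofPred_eq, lt_getD_three_iff, threeRowFilling, Finset.mem_coe,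
      Finset.mem_union, Finset.mem_product, Finset.mem_singleton, Finset.mem_Ico, Finset.mem_range]
    grind
  rw [h, Set.ncard_coe_finset, Finset.card_union_of_disjoint, Finset.card_union_of_disjoint]
  · simp
  · rw [Finset.disjoint_left]
    simp only [Finset.mem_product, Finset.mem_singleton]
    grind
  · rw [Finset.disjoint_left]
    simp only [Finset.mem_union, Finset.mem_product, Finset.mem_singleton]
    grind

/-- In a weakly increasing row of length `n`, the entries `≤ k` form an initial segment. -/
theorem exists_threshold_of_row_weak {f : ℕ → ℕ} {n : ℕ}
    (hf : ∀ j, j + 1 < n → f j ≤ f (j + 1)) (k : ℕ) :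
    ∃ c ≤ n, ∀ j < n, f j ≤ k ↔ j < c := by
  induction n with
  | zero => exact ⟨0, le_rfl, by simp⟩
  | succ n ih =>
    obtain ⟨c, hc, h⟩ := ih fun j hj => hf j (by omega)
    by_cases hn : f n ≤ k
    · refine ⟨n + 1, le_rfl, fun j hj => ⟨fun _ => hj, fun _ => ?_⟩⟩
      have mono : ∀ d m, m + d = n → f m ≤ f n := by
        intro d
        induction d with
        | zero => rintro m rfl; rfl
        | succ d ihd => exact fun m hm => (hf m (by omega)).trans (ihd (m + 1) (by omega))
      exact (mono (n - j) j (by omega)).trans hn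
    · refine ⟨c, by omega, fun j hj => ?_⟩
      rcases Nat.lt_succ_iff_lt_or_eq.mp hj with hj | rfl
      · exact h j hj
      · exact ⟨fun h' => absurd h' hn, fun h' => by omega⟩

theorem kostka_three_eq {α₁ α₂ α₃ ξ₁ ξ₂ ξ₃ : ℕ} (h12 : α₂ ≤ α₁) (h23 : α₃ ≤ α₂)
    (hsum : ξ₁ + ξ₂ + ξ₃ = α₁ + α₂ + α₃) (h₃ : ξ₃ ≤ α₁) :
    kostka (fun i => [α₁, α₂, α₃].getD i 0) (fun k => [0, ξ₁, ξ₂, ξ₃].getD k 0) =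
      min (min α₂ (ξ₁ + ξ₂ - α₂)) (min ξ₁ ξ₂) + 1 - max α₃ (ξ₁ + ξ₂ - α₁) := by
  rw [← Nat.card_Icc, ← Set.ncard_coe_finset]
  have hinj : Set.InjOn (fun b => threeRowFilling α₁ α₂ α₃ ξ₁ (ξ₁ + ξ₂ - b) b)
      (Finset.Icc (max α₃ (ξ₁ + ξ₂ - α₁)) (min (min α₂ (ξ₁ + ξ₂ - α₂)) (min ξ₁ ξ₂)) :
        Finset ℕ) := by
    intro b hb b' hb' h
    have hb₁ := congrFun h (1, b)
    have hb₂ := congrFun h (1, b')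
    simp only [Finset.coe_Icc, Set.mem_Icc] at hb hb'
    simp only [threeRowFilling] at hb₁ hb₂
    grind
  rw [← hinj.ncard_image, kostka]
  refine (Nat.card_coe_set_eq {T : ℕ × ℕ → ℕ | _}).trans (congrArg Set.ncard (Set.ext fun T => ?_))
  simp only [Set.mem_ofPred_eq, Set.mem_image, Finset.coe_Icc, Set.mem_Icc]
  constructor
  · rintro ⟨hrow, hcol, hpos, hzero, hcontent⟩
    have hle : ∀ i j, j < [α₁, α₂, α₃].getD i 0 → T (i, j) ≤ 3 := by
      intro i j hj
      by_contra! hT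
      have hcard := hcontent (T (i, j)) (by omega)
      have hξ : [0, ξ₁, ξ₂, ξ₃].getD (T (i, j)) 0 = 0 :=
        List.getD_eq_default _ _ hT
      have hfin : {c : ℕ × ℕ | c.2 < [α₁, α₂, α₃].getD c.1 0 ∧ T c = T (i, j)}.Finite := by
        refine (Finset.range 3 ×ˢ Finset.range α₁).finite_toSet.subset ?_
        rintro ⟨i, j⟩ ⟨hc, -⟩
        simp only [lt_getD_three_iff] at hc
        simp only [Finset.mem_coe, Finset.mem_product, Finset.mem_range]
        omega
      rw [hξ, Set.ncard_eq_zero hfin] at hcard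
      exact Set.eq_empty_iff_forall_notMem.mp hcard (i, j) ⟨hj, rfl⟩
    have hcol₀ : ∀ j < α₂, T (0, j) < T (1, j) := hcol 0
    have hcol₁ : ∀ j < α₃, T (1, j) < T (2, j) := hcol 1
    have hpos₀ : ∀ j < α₁, 1 ≤ T (0, j) := hpos 0
    have hle₀ : ∀ j < α₁, T (0, j) ≤ 3 := hle 0
    have hle₁ : ∀ j < α₂, T (1, j) ≤ 3 := hle 1
    have hle₂ : ∀ j < α₃, T (2, j) ≤ 3 := hle 2
    obtain ⟨x, hx, hxT⟩ := exists_threshold_of_row_weak (f := fun j => T (0, j)) (hrow 0) 1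
    obtain ⟨a, ha, haT⟩ := exists_threshold_of_row_weak (f := fun j => T (0, j)) (hrow 0) 2
    obtain ⟨b, hb, hbT⟩ := exists_threshold_of_row_weak (f := fun j => T (1, j)) (hrow 1) 2
    simp only [List.getD_cons_zero, List.getD_cons_succ] at hx hxT ha haT hb hbT
    have hxa : x ≤ a := by
      by_contra! h
      have := hxT a (by omega)
      have := haT a (by omega)
      omega
    have hbx : b ≤ x := by
      by_contra! h
      have := hxT x (by omega)
      have := hbT x (by omega)
      have := hcol₀ x (by omega)
      omega
    have ha2 : α₂ ≤ a := by
      by_contra! h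
      have := haT a (by omega)
      have := hle₁ a (by omega)
      have := hcol₀ a (by omega)
      omega
    have hb3 : α₃ ≤ b := by
      by_contra! h
      have := hbT b (by omega)
      have := hle₂ b (by omega)
      have := hcol₁ b (by omega)
      omega
    have hT : T = threeRowFilling α₁ α₂ α₃ x a b := by
      funext ⟨i, j⟩
      by_cases hj : j < [α₁, α₂, α₃].getD i 0
      · rw [lt_getD_three_iff] at hj
        simp only [threeRowFilling]
        rcases hj with ⟨rfl, hj⟩ | ⟨rfl, hj⟩ | ⟨rfl, hj⟩
        · grind
        · grind
        · grind
      · rw [hzero i j (not_lt.mp hj)]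
        rw [lt_getD_three_iff] at hj
        simp only [threeRowFilling]
        grind
    subst hT
    have h1 := hcontent 1 le_rfl
    have h2 := hcontent 2 (by norm_num)
    rw [ncard_threeRowFilling_eq_one hxa ha] at h1
    rw [ncard_threeRowFilling_eq_two ha hb] at h2
    simp only [List.getD_cons_zero, List.getD_cons_succ] at h1 h2
    refine ⟨b, by omega, ?_⟩
    rw [← h1, show x + ξ₂ - b = a by omega]
  · rintro ⟨b, hb, rfl⟩
    refine ⟨fun i j hj => ?_, fun i j hj => ?_, fun i j hj => ?_, fun i j hj => ?_, fun k hk => ?_⟩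
    · rw [lt_getD_three_iff] at hj
      simp only [threeRowFilling]
      grind
    · rw [lt_getD_three_iff] at hj
      simp only [threeRowFilling]
      grind
    · rw [lt_getD_three_iff] at hj
      simp only [threeRowFilling]
      grind
    · rw [← not_lt, lt_getD_three_iff] at hj
      simp only [threeRowFilling]
      grind
    · obtain rfl | rfl | rfl | hk4 : k = 1 ∨ k = 2 ∨ k = 3 ∨ 4 ≤ k := by omega
      · rw [ncard_threeRowFilling_eq_one (by omega) (by omega)]
        rfl
      · rw [ncard_threeRowFilling_eq_two (by omega) (by omega)]
        simp only [List.getD_cons_zero, List.getD_cons_succ]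
        omega
      · rw [ncard_threeRowFilling_eq_three (by omega)]
        simp only [List.getD_cons_zero, List.getD_cons_succ]
        omega
      · rw [List.getD_eq_default _ _ (by simpa using hk4)]
        convert Set.ncard_empty (ℕ × ℕ)
        refine Set.eq_empty_of_forall_notMem fun c hc => ?_
        have := hc.2
        simp only [threeRowFilling] at this
        grind

/-- Stretched `su(3)` Kostka numbers: if `α₁ ≥ α₂ ≥ α₃ ≥ 0`, `ξ₁ + ξ₂ + ξ₃ = α₁ + α₂ + α₃`
and `α₃ ≤ ξᵢ ≤ α₁` for each `i` (i.e. `ξ` lies in the permutahedron of `α`), then for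
every `p ≥ 1`, `K_{pα}(pξ) = p·(K_α(ξ) − 1) + 1`: the stretched Kostka number is a linear
polynomial in `p` with leading coefficient the Schur volume `ℐ_{su(3)}(α;ξ) = K_α(ξ) − 1`. -/
theorem kostka_su3_stretched
    (α₁ α₂ α₃ ξ₁ ξ₂ ξ₃ : ℕ) (h12 : α₂ ≤ α₁) (h23 : α₃ ≤ α₂)
    (hsum : ξ₁ + ξ₂ + ξ₃ = α₁ + α₂ + α₃)
    (hperm : ∀ ξ ∈ ({ξ₁, ξ₂, ξ₃} : Set ℕ), α₃ ≤ ξ ∧ ξ ≤ α₁)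
    (p : ℕ) (hp : 1 ≤ p) :
    (kostka (fun i => [p * α₁, p * α₂, p * α₃].getD i 0)
        (fun k => [0, p * ξ₁, p * ξ₂, p * ξ₃].getD k 0) : ℤ)
      = p * ((kostka (fun i => [α₁, α₂, α₃].getD i 0)
          (fun k => [0, ξ₁, ξ₂, ξ₃].getD k 0) : ℤ) - 1) + 1 := by
  obtain ⟨⟨h1l, h1u⟩, ⟨h2l, h2u⟩, h3l, h3u⟩ :
      (α₃ ≤ ξ₁ ∧ ξ₁ ≤ α₁) ∧ (α₃ ≤ ξ₂ ∧ ξ₂ ≤ α₁) ∧ α₃ ≤ ξ₃ ∧ ξ₃ ≤ α₁ :=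
    ⟨hperm _ (by simp), hperm _ (by simp), hperm _ (by simp)⟩
  rw [kostka_three_eq h12 h23 hsum h3u,
    kostka_three_eq (Nat.mul_le_mul_left p h12) (Nat.mul_le_mul_left p h23)
      (by rw [← mul_add, ← mul_add, hsum, mul_add, mul_add]) (Nat.mul_le_mul_left p h3u)]
  simp only [← mul_add, ← Nat.mul_sub, Nat.mul_min_mul_left, Nat.mul_max_mul_left]
  have hLU : max α₃ (ξ₁ + ξ₂ - α₁) ≤ min (min α₂ (ξ₁ + ξ₂ - α₂)) (min ξ₁ ξ₂) := by omega
  generalize max α₃ (ξ₁ + ξ₂ - α₁) = L at *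
  generalize min (min α₂ (ξ₁ + ξ₂ - α₂)) (min ξ₁ ξ₂) = U at *
  have hpLU := Nat.mul_le_mul_left p hLU
  rw [Nat.cast_sub (by omega), Nat.cast_sub (by omega)]
  push_cast
  ring
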